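/- arXiv:2502.19792 — 2 statements merged into one kernel-verified Lean document; each statement's English description precedes it below -/
import Mathlib

section
/- Let 𝔅 be nonsingular, b ∈ ℝ^l, w = [x; y; z] = 𝔅^{-1}b with L·w ≠ 0, and L ∈ ℝ^{k×l}; assume every entry of A, B, C, D, E and b is nonzero. For ε > 0 let S(ε) be the supremum of ( ‖L(𝔅+Δ𝔅)^{-1}(b+Δb) − L𝔅^{-1}b‖_∞ / ‖L·w‖_∞ ) / ‖ [vec(A‡⊙ΔA); vec(B‡⊙ΔB); vec(C‡⊙ΔC); vec(D‡⊙ΔD); vec(E‡⊙ΔE); b‡⊙Δb] ‖_∞ over all perturbations ΔA, ΔB, ΔC, ΔD, ΔE, Δb of matching sizes for which Δ𝔅 = [[ΔA, ΔBᵀ, 0],[ΔB, −ΔD, ΔCᵀ],[0, ΔC, ΔE]] makes 𝔅+Δ𝔅 nonsingular and the perturbation measure in the denominator lies in (0, ε]. Then S(ε) tends, as ε → 0⁺, to the partial mixed condition number ‖ |L·𝔅^{-1}·[𝒢, −I_l]| · [vec(|A|); vec(|B|); vec(|C|); vec(|D|); vec(|E|); |b|] ‖_∞ / ‖L·w‖_∞.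 -/
open Matrix Filter Topology

noncomputable section

/-- Index type for block vectors of sizes `n, m, p` (the paper's `l = n + m + p`). -/
abbrev Idx (n m p : ℕ) := Fin n ⊕ (Fin m ⊕ Fin p)

/-- Index type for the stacked vector `[vec A; vec B; vec C; vec D; vec E]`
(the paper's `s = n² + nm + mp + m² + p²`). -/
abbrev GIdx (n m p : ℕ) :=
  (Fin n × Fin n) ⊕ ((Fin n × Fin m) ⊕ ((Fin m × Fin p) ⊕ ((Fin m × Fin m) ⊕ (Fin p × Fin p))))

/-- Column-stacking vectorization of a `q × r` matrix: `vecC X (j, i) = X i j`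
(index = (column, row)). -/
def vecC {q r : ℕ} (X : Matrix (Fin q) (Fin r) ℝ) : Fin r × Fin q → ℝ := fun c => X c.2 c.1

/-- The double saddle point block matrix `[[A, Bᵀ, 0], [B, -D, Cᵀ], [0, C, E]]`. -/
def dsp {n m p : ℕ} (A : Matrix (Fin n) (Fin n) ℝ) (B : Matrix (Fin m) (Fin n) ℝ)
    (C : Matrix (Fin p) (Fin m) ℝ) (D : Matrix (Fin m) (Fin m) ℝ)
    (E : Matrix (Fin p) (Fin p) ℝ) : Matrix (Idx n m p) (Idx n m p) ℝ :=
  Matrix.of fun i j =>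
    match i, j with
    | Sum.inl i, Sum.inl j => A i j
    | Sum.inl i, Sum.inr (Sum.inl j) => Bᵀ i j
    | Sum.inl _, Sum.inr (Sum.inr _) => 0
    | Sum.inr (Sum.inl i), Sum.inl j => B i j
    | Sum.inr (Sum.inl i), Sum.inr (Sum.inl j) => -D i j
    | Sum.inr (Sum.inl i), Sum.inr (Sum.inr j) => Cᵀ i j
    | Sum.inr (Sum.inr _), Sum.inl _ => 0
    | Sum.inr (Sum.inr i), Sum.inr (Sum.inl j) => C i j
    | Sum.inr (Sum.inr i), Sum.inr (Sum.inr j) => E i j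

/-- The matrix `𝒢 = [[xᵀ⊗Iₙ, Iₙ⊗yᵀ, 0, 0, 0], [0, xᵀ⊗Iₘ, Iₘ⊗zᵀ, -(yᵀ⊗Iₘ), 0],
[0, 0, yᵀ⊗Iₚ, 0, zᵀ⊗Iₚ]] ∈ ℝ^{l×s}`, written entrywise with respect to the
column-stacking indices (so that `𝒢 ·ᵥ [vec ΔA; vec ΔB; vec ΔC; vec ΔD; vec ΔE]`
is exactly the action of the Kronecker-product block matrix of the paper). -/
def calG {n m p : ℕ} (x : Fin n → ℝ) (y : Fin m → ℝ) (z : Fin p → ℝ) :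
    Matrix (Idx n m p) (GIdx n m p) ℝ :=
  Matrix.of fun i c =>
    match i, c with
    | Sum.inl i, Sum.inl (j, i') => x j * (if i = i' then 1 else 0)
    | Sum.inl i, Sum.inr (Sum.inl (j, i')) => (if i = j then 1 else 0) * y i'
    | Sum.inl _, Sum.inr (Sum.inr (Sum.inl _)) => 0
    | Sum.inl _, Sum.inr (Sum.inr (Sum.inr (Sum.inl _))) => 0
    | Sum.inl _, Sum.inr (Sum.inr (Sum.inr (Sum.inr _))) => 0
    | Sum.inr (Sum.inl _), Sum.inl _ => 0
    | Sum.inr (Sum.inl i), Sum.inr (Sum.inl (j, i')) => x j * (if i = i' then 1 else 0)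
    | Sum.inr (Sum.inl i), Sum.inr (Sum.inr (Sum.inl (j, i'))) => (if i = j then 1 else 0) * z i'
    | Sum.inr (Sum.inl i), Sum.inr (Sum.inr (Sum.inr (Sum.inl (j, i')))) =>
        -(y j * (if i = i' then 1 else 0))
    | Sum.inr (Sum.inl _), Sum.inr (Sum.inr (Sum.inr (Sum.inr _))) => 0
    | Sum.inr (Sum.inr _), Sum.inl _ => 0
    | Sum.inr (Sum.inr _), Sum.inr (Sum.inl _) => 0
    | Sum.inr (Sum.inr i), Sum.inr (Sum.inr (Sum.inl (j, i'))) => y j * (if i = i' then 1 else 0)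
    | Sum.inr (Sum.inr _), Sum.inr (Sum.inr (Sum.inr (Sum.inl _))) => 0
    | Sum.inr (Sum.inr i), Sum.inr (Sum.inr (Sum.inr (Sum.inr (j, i')))) =>
        z j * (if i = i' then 1 else 0)

/-- The stacked vector `[vec A; vec B; vec C; vec D; vec E]`. -/
def vecG {n m p : ℕ} (A : Matrix (Fin n) (Fin n) ℝ) (B : Matrix (Fin m) (Fin n) ℝ)
    (C : Matrix (Fin p) (Fin m) ℝ) (D : Matrix (Fin m) (Fin m) ℝ)
    (E : Matrix (Fin p) (Fin p) ℝ) : GIdx n m p → ℝ :=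
  Sum.elim (vecC A) (Sum.elim (vecC B) (Sum.elim (vecC C) (Sum.elim (vecC D) (vecC E))))

/-- Euclidean norm of a vector. -/
def euclNorm {ι : Type*} [Fintype ι] (v : ι → ℝ) : ℝ := Real.sqrt (∑ i, v i ^ 2)

/-- Spectral norm (largest singular value = induced 2-norm) of a real matrix. -/
def specNorm {a b : Type*} [Fintype a] [Fintype b] (M : Matrix a b ℝ) : ℝ :=
  sSup {r : ℝ | ∃ v : b → ℝ, euclNorm v = 1 ∧ r = euclNorm (M.mulVec v)}

/-- Max-norm (`‖·‖_∞`) of a vector. -/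
def infNormV {ι : Type*} [Fintype ι] (v : ι → ℝ) : ℝ := ⨆ i, |v i|

/-- Induced ∞-norm of a matrix: the maximum absolute row sum. -/
def infNormM {a b : Type*} [Fintype a] [Fintype b] (M : Matrix a b ℝ) : ℝ :=
  ⨆ i, ∑ j, |M i j|

/-- Horizontal (block-column) concatenation `[M, N]`. -/
def hcat {a b c : Type*} (M : Matrix a b ℝ) (N : Matrix a c ℝ) : Matrix a (b ⊕ c) ℝ :=
  Matrix.of fun i => Sum.elim (M i) (N i)

/-- Entrywise absolute value of a matrix. -/
def absM {a b : Type*} (M : Matrix a b ℝ) : Matrix a b ℝ := Matrix.of fun i j => |M i j|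

/-- Entrywise absolute value of a vector. -/
def absV {ι : Type*} (v : ι → ℝ) : ι → ℝ := fun i => |v i|

/-- The matrix `𝒥 = [[(‖x‖₂²+‖y‖₂²)Iₙ, xyᵀ, 0], [yxᵀ, (‖x‖₂²+‖y‖₂²+‖z‖₂²)Iₘ, yzᵀ],
[0, zyᵀ, (‖y‖₂²+‖z‖₂²)Iₚ]]`. -/
def calJ {n m p : ℕ} (x : Fin n → ℝ) (y : Fin m → ℝ) (z : Fin p → ℝ) :
    Matrix (Idx n m p) (Idx n m p) ℝ :=
  Matrix.of fun i j =>
    match i, j with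
    | Sum.inl i, Sum.inl j => (euclNorm x ^ 2 + euclNorm y ^ 2) * (if i = j then 1 else 0)
    | Sum.inl i, Sum.inr (Sum.inl j) => x i * y j
    | Sum.inl _, Sum.inr (Sum.inr _) => 0
    | Sum.inr (Sum.inl i), Sum.inl j => y i * x j
    | Sum.inr (Sum.inl i), Sum.inr (Sum.inl j) =>
        (euclNorm x ^ 2 + euclNorm y ^ 2 + euclNorm z ^ 2) * (if i = j then 1 else 0)
    | Sum.inr (Sum.inl i), Sum.inr (Sum.inr j) => y i * z j
    | Sum.inr (Sum.inr _), Sum.inl _ => 0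
    | Sum.inr (Sum.inr i), Sum.inr (Sum.inl j) => z i * y j
    | Sum.inr (Sum.inr i), Sum.inr (Sum.inr j) =>
        (euclNorm y ^ 2 + euclNorm z ^ 2) * (if i = j then 1 else 0)

/-- The scaled perturbation vector
`[vec(Ψ_A‡⊙ΔA); vec(Ψ_B‡⊙ΔB); vec(Ψ_C‡⊙ΔC); vec(Ψ_D‡⊙ΔD); vec(Ψ_E‡⊙ΔE); χ‡⊙Δb]`
(for data with all entries nonzero, `v‡` is the entrywise reciprocal). -/
def scaledPert {n m p : ℕ} (ΨA : Matrix (Fin n) (Fin n) ℝ) (ΨB : Matrix (Fin m) (Fin n) ℝ)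
    (ΨC : Matrix (Fin p) (Fin m) ℝ) (ΨD : Matrix (Fin m) (Fin m) ℝ)
    (ΨE : Matrix (Fin p) (Fin p) ℝ) (χ : Idx n m p → ℝ)
    (ΔA : Matrix (Fin n) (Fin n) ℝ) (ΔB : Matrix (Fin m) (Fin n) ℝ)
    (ΔC : Matrix (Fin p) (Fin m) ℝ) (ΔD : Matrix (Fin m) (Fin m) ℝ)
    (ΔE : Matrix (Fin p) (Fin p) ℝ) (Δb : Idx n m p → ℝ) : GIdx n m p ⊕ Idx n m p → ℝ :=
  Sum.elim (fun c => (vecG ΨA ΨB ΨC ΨD ΨE c)⁻¹ * vecG ΔA ΔB ΔC ΔD ΔE c)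
    (fun i => (χ i)⁻¹ * Δb i)

/-- The vector `ℋ = [|A||x| + |B|ᵀ|y|; |B||x| + |D||y| + |C|ᵀ|z|; |C||y| + |E||z|]`. -/
def calH {n m p : ℕ} (A : Matrix (Fin n) (Fin n) ℝ) (B : Matrix (Fin m) (Fin n) ℝ)
    (C : Matrix (Fin p) (Fin m) ℝ) (D : Matrix (Fin m) (Fin m) ℝ)
    (E : Matrix (Fin p) (Fin p) ℝ) (x : Fin n → ℝ) (y : Fin m → ℝ) (z : Fin p → ℝ) :
    Idx n m p → ℝ :=
  Sum.elim ((absM A).mulVec (absV x) + (absM B)ᵀ.mulVec (absV y))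
    (Sum.elim
      ((absM B).mulVec (absV x) + (absM D).mulVec (absV y) + (absM C)ᵀ.mulVec (absV z))
      ((absM C).mulVec (absV y) + (absM E).mulVec (absV z)))

/-- Index type of the structured (generating-vector) parameter space
`[a; vec B; vec C; d; e]`. -/
abbrev SIdx (n m p s₁ r q : ℕ) :=
  Fin s₁ ⊕ (((Fin n × Fin m) ⊕ (Fin m × Fin p)) ⊕ (Fin r ⊕ Fin q))

/-- `Φ_S = blkdiag(Φ₁, I_{nm+mp}, Φ₂, Φ₃)`. -/
def PhiS {n m p s₁ r q : ℕ} (Φ₁ : Matrix (Fin n × Fin n) (Fin s₁) ℝ)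
    (Φ₂ : Matrix (Fin m × Fin m) (Fin r) ℝ) (Φ₃ : Matrix (Fin p × Fin p) (Fin q) ℝ) :
    Matrix (GIdx n m p) (SIdx n m p s₁ r q) ℝ :=
  Matrix.of fun i j =>
    match i, j with
    | Sum.inl i, Sum.inl j => Φ₁ i j
    | Sum.inr (Sum.inl i), Sum.inr (Sum.inl (Sum.inl j)) => if i = j then 1 else 0
    | Sum.inr (Sum.inr (Sum.inl i)), Sum.inr (Sum.inl (Sum.inr j)) => if i = j then 1 else 0
    | Sum.inr (Sum.inr (Sum.inr (Sum.inl i))), Sum.inr (Sum.inr (Sum.inl j)) => Φ₂ i j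
    | Sum.inr (Sum.inr (Sum.inr (Sum.inr i))), Sum.inr (Sum.inr (Sum.inr j)) => Φ₃ i j
    | _, _ => 0

/-- The structured scaled perturbation vector
`[ψ_A‡⊙Δa; vec(Ψ_B‡⊙ΔB); vec(Ψ_C‡⊙ΔC); ψ_D‡⊙Δd; ψ_E‡⊙Δe; χ‡⊙Δb]`. -/
def structPert {n m p s₁ r q : ℕ} (ψA : Fin s₁ → ℝ) (ΨB : Matrix (Fin m) (Fin n) ℝ)
    (ΨC : Matrix (Fin p) (Fin m) ℝ) (ψD : Fin r → ℝ) (ψE : Fin q → ℝ) (χ : Idx n m p → ℝ)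
    (Δa : Fin s₁ → ℝ) (ΔB : Matrix (Fin m) (Fin n) ℝ) (ΔC : Matrix (Fin p) (Fin m) ℝ)
    (Δd : Fin r → ℝ) (Δe : Fin q → ℝ) (Δb : Idx n m p → ℝ) :
    SIdx n m p s₁ r q ⊕ Idx n m p → ℝ :=
  Sum.elim
    (Sum.elim (fun j => (ψA j)⁻¹ * Δa j)
      (Sum.elim
        (Sum.elim (fun c => (vecC ΨB c)⁻¹ * vecC ΔB c) (fun c => (vecC ΨC c)⁻¹ * vecC ΔC c))
        (Sum.elim (fun j => (ψD j)⁻¹ * Δd j) (fun j => (ψE j)⁻¹ * Δe j))))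
    (fun i => (χ i)⁻¹ * Δb i)

/-- The EILS augmented matrix `𝔅̂ = [[0, 0, C], [0, J, M], [Cᵀ, Mᵀ, 0]]`
(block sizes `p, n, m`). -/
def eilsAug {n m p : ℕ} (J : Matrix (Fin n) (Fin n) ℝ) (M : Matrix (Fin n) (Fin m) ℝ)
    (C : Matrix (Fin p) (Fin m) ℝ) :
    Matrix (Fin p ⊕ (Fin n ⊕ Fin m)) (Fin p ⊕ (Fin n ⊕ Fin m)) ℝ :=
  Matrix.of fun i j =>
    match i, j with
    | Sum.inl i, Sum.inr (Sum.inr j) => C i j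
    | Sum.inr (Sum.inl i), Sum.inr (Sum.inl j) => J i j
    | Sum.inr (Sum.inl i), Sum.inr (Sum.inr j) => M i j
    | Sum.inr (Sum.inr i), Sum.inl j => Cᵀ i j
    | Sum.inr (Sum.inr i), Sum.inr (Sum.inl j) => Mᵀ i j
    | _, _ => 0

/-- The block permutation matrix `Σ = [[0, Iₙ, 0], [0, 0, Iₘ], [I_p, 0, 0]]`
(block rows of sizes `n, m, p`; block columns of sizes `p, n, m`). -/
def sigmaPerm (n m p : ℕ) : Matrix (Idx n m p) (Fin p ⊕ (Fin n ⊕ Fin m)) ℝ :=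
  Matrix.of fun i j =>
    match i, j with
    | Sum.inl i, Sum.inr (Sum.inl j) => if i = j then 1 else 0
    | Sum.inr (Sum.inl i), Sum.inr (Sum.inr j) => if i = j then 1 else 0
    | Sum.inr (Sum.inr i), Sum.inl j => if i = j then 1 else 0
    | _, _ => 0

/-- The matrix `𝒢̂ = [[yᵀ⊗Iₙ, 0], [Iₘ⊗xᵀ, Iₘ⊗zᵀ], [0, yᵀ⊗I_p]] ∈ ℝ^{l×m(n+p)}`,
written entrywise with respect to column-stacking indices of `[vec(ΔBᵀ); vec(ΔC)]`. -/
def hatG {n m p : ℕ} (x : Fin n → ℝ) (y : Fin m → ℝ) (z : Fin p → ℝ) :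
    Matrix (Idx n m p) ((Fin m × Fin n) ⊕ (Fin m × Fin p)) ℝ :=
  Matrix.of fun i c =>
    match i, c with
    | Sum.inl i, Sum.inl (j, i') => y j * (if i = i' then 1 else 0)
    | Sum.inl _, Sum.inr _ => 0
    | Sum.inr (Sum.inl i), Sum.inl (j, i') => (if i = j then 1 else 0) * x i'
    | Sum.inr (Sum.inl i), Sum.inr (j, i') => (if i = j then 1 else 0) * z i'
    | Sum.inr (Sum.inr _), Sum.inl _ => 0
    | Sum.inr (Sum.inr i), Sum.inr (j, i') => y j * (if i = i' then 1 else 0)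

theorem ContinuousAt.tendsto_sSup_norm_apply_div_norm {E G : Type*} [NormedAddCommGroup E]
    [NormedSpace ℝ E] [Nontrivial E] [NormedAddCommGroup G] [NormedSpace ℝ G]
    {P : E → E →L[ℝ] G} (hP : ContinuousAt P 0) {U : Set E} (hU : U ∈ 𝓝 (0 : E)) :
    Tendsto (fun ε : ℝ => sSup {t : ℝ | ∃ u ∈ U, 0 < ‖u‖ ∧ ‖u‖ ≤ ε ∧ t = ‖P u u‖ / ‖u‖})
      (𝓝[>] 0) (𝓝 ‖P 0‖) := by
  rw [Metric.tendsto_nhds]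
  intro η hη
  obtain ⟨δ, hδ, hball⟩ := Metric.eventually_nhds_iff.1
    (((Metric.continuousAt_iff'.1 hP) (η / 3) (by positivity)).and hU)
  obtain ⟨v, hv, hPv⟩ : ∃ v : E, v ≠ 0 ∧ (‖P 0‖ - η / 3) * ‖v‖ ≤ ‖P 0 v‖ := by
    by_contra! hlt
    obtain ⟨v, hv⟩ := exists_ne (0 : E)
    have hpos : 0 < ‖P 0‖ - η / 3 :=
      pos_of_mul_pos_left ((norm_nonneg _).trans_lt (hlt v hv)) (norm_nonneg v)
    have hle : ‖P 0‖ ≤ ‖P 0‖ - η / 3 := by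
      refine (P 0).opNorm_le_bound hpos.le fun u => ?_
      rcases eq_or_ne u 0 with rfl | hu
      · simp
      · exact (hlt u hu).le
    linarith
  have hdiff : ∀ u : E, ‖u‖ < δ → ‖P u u - P 0 u‖ ≤ η / 3 * ‖u‖ := fun u hu => by
    have hlt := (hball (y := u) (by simpa using hu)).1
    rw [dist_eq_norm] at hlt
    exact ((P u - P 0).le_opNorm u).trans (by gcongr)
  filter_upwards [Ioo_mem_nhdsGT hδ] with ε hε
  have hub : ∀ t ∈ {t : ℝ | ∃ u ∈ U, 0 < ‖u‖ ∧ ‖u‖ ≤ ε ∧ t = ‖P u u‖ / ‖u‖},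
      t ≤ ‖P 0‖ + η / 3 := by
    rintro t ⟨u, -, hu, huε, rfl⟩
    rw [div_le_iff₀ hu]
    have h1 := hdiff u (huε.trans_lt hε.2)
    have h2 := (P 0).le_opNorm u
    have h3 := norm_le_norm_add_norm_sub' (P u u) (P 0 u)
    linarith
  have hv' : 0 < ‖v‖ := norm_pos_iff.2 hv
  set u : E := (ε / ‖v‖) • v with hu
  have hnu : ‖u‖ = ε := by
    rw [hu, norm_smul, Real.norm_of_nonneg (div_pos hε.1 hv').le, div_mul_cancel₀ _ hv'.ne']
  have hmem : ‖P u u‖ / ‖u‖ ∈ {t : ℝ | ∃ u ∈ U, 0 < ‖u‖ ∧ ‖u‖ ≤ ε ∧ t = ‖P u u‖ / ‖u‖} :=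
    ⟨u, (hball (by simpa [hnu] using hε.2)).2, hnu ▸ hε.1, hnu.le, rfl⟩
  have hlow : ‖P 0‖ - 2 * (η / 3) ≤ ‖P u u‖ / ‖u‖ := by
    have h1 := hdiff u (hnu ▸ hε.2)
    have h2 : (‖P 0‖ - η / 3) * ‖u‖ ≤ ‖P 0 u‖ := by
      have hc : 0 < ε / ‖v‖ := div_pos hε.1 hv'
      rw [hu, map_smul, norm_smul, norm_smul, Real.norm_of_nonneg hc.le]
      nlinarith
    have h3 := norm_sub_norm_le (P 0 u) (P u u)
    rw [norm_sub_rev] at h3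
    rw [le_div_iff₀ (hnu ▸ hε.1)]
    linarith
  have h1 := le_csSup ⟨_, hub⟩ hmem
  have h2 := csSup_le ⟨_, hmem⟩ hub
  rw [Real.dist_eq, abs_lt]
  constructor <;> linarith

theorem infNormV_eq_norm {ι : Type*} [Fintype ι] (v : ι → ℝ) : infNormV v = ‖v‖ := by
  refine le_antisymm (Real.iSup_le (fun i => norm_le_pi_norm v i) (norm_nonneg v)) ?_
  refine (pi_norm_le_iff_of_nonneg (Real.iSup_nonneg fun i => abs_nonneg (v i))).2 fun i => ?_
  exact le_ciSup (f := fun i => |v i|) (Set.finite_range _).bddAbove i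

/-- Multiplication by a matrix, as a linear map into continuous linear maps. -/
def mulVecCLM {κ ι : Type*} [Fintype κ] [Fintype ι] [DecidableEq ι] :
    Matrix κ ι ℝ →ₗ[ℝ] ((ι → ℝ) →L[ℝ] (κ → ℝ)) :=
  (LinearMap.toContinuousLinearMap (𝕜 := ℝ) (E := ι → ℝ) (F' := κ → ℝ)).toLinearMap ∘ₗ
    (Matrix.toLin' (R := ℝ) (m := κ) (n := ι)).toLinearMap

theorem mulVecCLM_apply {κ ι : Type*} [Fintype κ] [Fintype ι] [DecidableEq ι]
    (M : Matrix κ ι ℝ) (u : ι → ℝ) : mulVecCLM M u = M *ᵥ u := by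
  simp [mulVecCLM]

theorem norm_mulVecCLM {κ ι : Type*} [Fintype κ] [Fintype ι] [DecidableEq ι]
    (M : Matrix κ ι ℝ) : ‖mulVecCLM M‖ = ‖absM M *ᵥ (fun _ => 1)‖ := by
  let := Matrix.linftyOpNormedAddCommGroup (m := κ) (n := ι) (α := ℝ)
  have h : mulVecCLM M = ContinuousLinearMap.mk (Matrix.mulVecLin M) := by
    ext1 u
    exact mulVecCLM_apply M u
  rw [h, ← Matrix.linfty_opNorm_eq_opNorm, Matrix.linfty_opNorm_def, Pi.norm_def]
  congr 2
  ext1 i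
  ext
  simp only [absM, mulVec, dotProduct, of_apply, mul_one, NNReal.coe_sum, coe_nnnorm,
    Real.norm_eq_abs]
  exact (abs_of_nonneg (Finset.sum_nonneg fun _ _ => abs_nonneg _)).symm

/-- The double saddle point matrix assembled from its stacked block entries. -/
def dspOfVec {n m p : ℕ} (v : GIdx n m p → ℝ) : Matrix (Idx n m p) (Idx n m p) ℝ :=
  dsp (of fun i j => v (.inl (j, i))) (of fun i j => v (.inr (.inl (j, i))))
    (of fun i j => v (.inr (.inr (.inl (j, i)))))
    (of fun i j => v (.inr (.inr (.inr (.inl (j, i))))))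
    (of fun i j => v (.inr (.inr (.inr (.inr (j, i))))))

theorem dspOfVec_vecG {n m p : ℕ} (A : Matrix (Fin n) (Fin n) ℝ) (B : Matrix (Fin m) (Fin n) ℝ)
    (C : Matrix (Fin p) (Fin m) ℝ) (D : Matrix (Fin m) (Fin m) ℝ)
    (E : Matrix (Fin p) (Fin p) ℝ) : dspOfVec (vecG A B C D E) = dsp A B C D E := rfl

theorem exists_vecG_eq {n m p : ℕ} (v : GIdx n m p → ℝ) :
    ∃ A B C D E, vecG A B C D E = v := by
  refine ⟨fun i j => v (.inl (j, i)), fun i j => v (.inr (.inl (j, i))),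
    fun i j => v (.inr (.inr (.inl (j, i)))), fun i j => v (.inr (.inr (.inr (.inl (j, i))))),
    fun i j => v (.inr (.inr (.inr (.inr (j, i))))), ?_⟩
  ext (c | c | c | c | c) <;> rfl

theorem dspOfVec_zero {n m p : ℕ} : dspOfVec (0 : GIdx n m p → ℝ) = 0 := by
  ext (i | i | i) (j | j | j) <;> simp [dspOfVec, dsp]

theorem continuous_dspOfVec {n m p : ℕ} : Continuous (dspOfVec : (GIdx n m p → ℝ) → _) := by
  refine continuous_matrix fun i j => ?_
  rcases i with i | i | i <;> rcases j with j | j | j <;>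
    simp only [dspOfVec, dsp, of_apply, transpose_apply] <;> fun_prop

theorem dspOfVec_mulVec {n m p : ℕ} (v : GIdx n m p → ℝ) (x : Fin n → ℝ) (y : Fin m → ℝ)
    (z : Fin p → ℝ) :
    dspOfVec v *ᵥ Sum.elim x (Sum.elim y z) = calG x y z *ᵥ v := by
  ext (i | i | i) <;>
    simp [mulVec, dotProduct, dspOfVec, dsp, calG, Fintype.sum_sum_type, Fintype.sum_prod_type,
      mul_comm]
  exact add_comm _ _

theorem vecG_ne_zero {n m p : ℕ} {A : Matrix (Fin n) (Fin n) ℝ} {B : Matrix (Fin m) (Fin n) ℝ}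
    {C : Matrix (Fin p) (Fin m) ℝ} {D : Matrix (Fin m) (Fin m) ℝ} {E : Matrix (Fin p) (Fin p) ℝ}
    (hA : ∀ i j, A i j ≠ 0) (hB : ∀ i j, B i j ≠ 0) (hC : ∀ i j, C i j ≠ 0)
    (hD : ∀ i j, D i j ≠ 0) (hE : ∀ i j, E i j ≠ 0) (c : GIdx n m p) :
    vecG A B C D E c ≠ 0 := by
  rcases c with c | c | c | c | c <;> simp [vecG, vecC, *]

theorem vecG_absM {n m p : ℕ} (A : Matrix (Fin n) (Fin n) ℝ) (B : Matrix (Fin m) (Fin n) ℝ)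
    (C : Matrix (Fin p) (Fin m) ℝ) (D : Matrix (Fin m) (Fin m) ℝ)
    (E : Matrix (Fin p) (Fin p) ℝ) :
    vecG (absM A) (absM B) (absM C) (absM D) (absM E) = absV (vecG A B C D E) := by
  ext (c | c | c | c | c) <;> rfl

theorem absM_mul_diagonal_mulVec_one {κ ι : Type*} [Fintype ι] [DecidableEq ι]
    (K : Matrix κ ι ℝ) (h : ι → ℝ) :
    absM (K * diagonal h) *ᵥ (fun _ => 1) = absM K *ᵥ absV h := by
  ext i
  simp [absM, absV, mulVec, dotProduct, mul_diagonal, abs_mul]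

/-- Exact forward error of a perturbed linear system. -/
theorem inv_mulVec_add_sub_inv_mulVec {ι : Type*} [Fintype ι] [DecidableEq ι]
    {M N : Matrix ι ι ℝ} (hM : IsUnit M.det) (hMN : IsUnit (M + N).det) (b d : ι → ℝ) :
    (M + N)⁻¹ *ᵥ (b + d) - M⁻¹ *ᵥ b = (M + N)⁻¹ *ᵥ (d - N *ᵥ (M⁻¹ *ᵥ b)) := by
  have h : (M + N) *ᵥ (M⁻¹ *ᵥ b) = b + N *ᵥ (M⁻¹ *ᵥ b) := by
    rw [add_mulVec, mulVec_mulVec, mul_nonsing_inv _ hM, one_mulVec]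
  have h' : M⁻¹ *ᵥ b = (M + N)⁻¹ *ᵥ (b + N *ᵥ (M⁻¹ *ᵥ b)) := by
    rw [← h, mulVec_mulVec (M⁻¹ *ᵥ b), nonsing_inv_mul _ hMN, one_mulVec]
  conv_lhs => rw [h', ← mulVec_sub]
  congr 1
  abel

theorem hcat_neg_one_mulVec {ι γ : Type*} [Fintype ι] [DecidableEq ι] [Fintype γ]
    (M : Matrix ι γ ℝ) (v : γ ⊕ ι → ℝ) :
    hcat M (-1 : Matrix ι ι ℝ) *ᵥ v = M *ᵥ (fun c => v (.inl c)) - fun i => v (.inr i) := by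
  ext i
  simp [hcat, mulVec, dotProduct, Fintype.sum_sum_type, one_apply, sub_eq_add_neg]

/-- partial mixed condition number, eq. (3.8). -/
theorem stmt8 {n m p k : ℕ}
    (A : Matrix (Fin n) (Fin n) ℝ) (B : Matrix (Fin m) (Fin n) ℝ) (C : Matrix (Fin p) (Fin m) ℝ)
    (D : Matrix (Fin m) (Fin m) ℝ) (E : Matrix (Fin p) (Fin p) ℝ)
    (hB : IsUnit (dsp A B C D E).det) (b : Idx n m p → ℝ)
    (x : Fin n → ℝ) (y : Fin m → ℝ) (z : Fin p → ℝ)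
    (hw : Sum.elim x (Sum.elim y z) = ((dsp A B C D E)⁻¹).mulVec b)
    (L : Matrix (Fin k) (Idx n m p) ℝ)
    (hLw : L.mulVec (Sum.elim x (Sum.elim y z)) ≠ 0)
    (hA : ∀ i j, A i j ≠ 0) (hb : ∀ i j, B i j ≠ 0) (hC : ∀ i j, C i j ≠ 0)
    (hD : ∀ i j, D i j ≠ 0) (hE : ∀ i j, E i j ≠ 0) (hbv : ∀ i, b i ≠ 0) :
    Tendsto (fun ε : ℝ => sSup {t : ℝ |
        ∃ (ΔA : Matrix (Fin n) (Fin n) ℝ) (ΔB : Matrix (Fin m) (Fin n) ℝ)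
          (ΔC : Matrix (Fin p) (Fin m) ℝ) (ΔD : Matrix (Fin m) (Fin m) ℝ)
          (ΔE : Matrix (Fin p) (Fin p) ℝ) (Δb : Idx n m p → ℝ),
          IsUnit (dsp A B C D E + dsp ΔA ΔB ΔC ΔD ΔE).det ∧
          0 < infNormV (scaledPert A B C D E b ΔA ΔB ΔC ΔD ΔE Δb) ∧
          infNormV (scaledPert A B C D E b ΔA ΔB ΔC ΔD ΔE Δb) ≤ ε ∧
          t = (infNormV (L.mulVec (((dsp A B C D E + dsp ΔA ΔB ΔC ΔD ΔE)⁻¹).mulVec (b + Δb))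
                  - L.mulVec (((dsp A B C D E)⁻¹).mulVec b)) /
                infNormV (L.mulVec (Sum.elim x (Sum.elim y z)))) /
              infNormV (scaledPert A B C D E b ΔA ΔB ΔC ΔD ΔE Δb)})
      (𝓝[>] 0)
      (𝓝 (infNormV ((absM (L * (dsp A B C D E)⁻¹ *
            hcat (calG x y z) (-1 : Matrix (Idx n m p) (Idx n m p) ℝ))).mulVec
          (Sum.elim (vecG (absM A) (absM B) (absM C) (absM D) (absM E)) (absV b))) /
        infNormV (L.mulVec (Sum.elim x (Sum.elim y z))))) := by
  set a := vecG A B C D E with ha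
  set M := dsp A B C D E with hM
  set w := Sum.elim x (Sum.elim y z) with hwdef
  set h : GIdx n m p ⊕ Idx n m p → ℝ := Sum.elim a b with hh
  set c := infNormV (L *ᵥ w) with hc
  set H := -(hcat (calG x y z) (-1 : Matrix (Idx n m p) (Idx n m p) ℝ) * diagonal h) with hH
  set N : (GIdx n m p ⊕ Idx n m p → ℝ) → Matrix (Idx n m p) (Idx n m p) ℝ :=
    fun u => dspOfVec fun i => a i * u (.inl i) with hN
  have ha0 : ∀ i, a i ≠ 0 := vecG_ne_zero hA hb hC hD hE
  have hN0 : N 0 = 0 := by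
    simpa [hN, Pi.zero_def] using dspOfVec_zero (n := n) (m := m) (p := p)
  have hNcont : Continuous N := continuous_dspOfVec.comp (by fun_prop)
  have hMN : Continuous fun u => M + N u := continuous_const.add hNcont
  have hdet : (M + N 0).det ≠ 0 := by
    rw [hN0, add_zero]
    exact hB.ne_zero
  have hU : {u | IsUnit (M + N u).det} ∈ 𝓝 0 := by
    simp only [isUnit_iff_ne_zero]
    exact hMN.matrix_det.continuousAt.eventually_ne hdet
  have hinv : ContinuousAt (fun u => (M + N u)⁻¹) 0 := by
    simp only [Matrix.inv_def, Ring.inverse_eq_inv']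
    exact (hMN.matrix_det.continuousAt.inv₀ hdet).smul hMN.matrix_adjugate.continuousAt
  have hP : ContinuousAt (fun u => c⁻¹ • mulVecCLM (L * (M + N u)⁻¹ * H)) 0 := by
    have hcont : Continuous (mulVecCLM (κ := Fin k) (ι := GIdx n m p ⊕ Idx n m p)) :=
      LinearMap.continuous_of_finiteDimensional _
    have hmul : Continuous fun Q : Matrix (Idx n m p) (Idx n m p) ℝ => L * Q * H := by fun_prop
    exact ((hcont.comp hmul).continuousAt.comp hinv).const_smul c⁻¹
  have hc0 : 0 ≤ c := by
    rw [hc, infNormV_eq_norm]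
    exact norm_nonneg _
  have : Nonempty (Idx n m p) := by
    by_contra hne
    rw [not_nonempty_iff] at hne
    exact hLw (by rw [Subsingleton.elim w 0, mulVec_zero])
  have hlim := hP.tendsto_sSup_norm_apply_div_norm hU
  have hnorm : ‖c⁻¹ • mulVecCLM (L * (M + N 0)⁻¹ * H)‖ =
      infNormV (absM (L * M⁻¹ * hcat (calG x y z) (-1 : Matrix (Idx n m p) (Idx n m p) ℝ)) *ᵥ
        Sum.elim (vecG (absM A) (absM B) (absM C) (absM D) (absM E)) (absV b)) / c := by
    have habs : Sum.elim (vecG (absM A) (absM B) (absM C) (absM D) (absM E)) (absV b) = absV h := by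
      rw [vecG_absM]
      ext (i | i) <;> rfl
    rw [norm_smul, norm_inv, Real.norm_of_nonneg hc0, hN0, add_zero, hH, Matrix.mul_neg, map_neg,
      norm_neg, ← Matrix.mul_assoc, norm_mulVecCLM, absM_mul_diagonal_mulVec_one, habs,
      infNormV_eq_norm, inv_mul_eq_div]
  have herr : ∀ u, IsUnit (M + N u).det →
      L *ᵥ ((M + N u)⁻¹ *ᵥ (b + fun i => b i * u (.inr i))) - L *ᵥ (M⁻¹ *ᵥ b) =
        (L * (M + N u)⁻¹ * H) *ᵥ u := by
    intro u hu
    rw [← mulVec_sub, inv_mulVec_add_sub_inv_mulVec hB hu, ← hw, mulVec_mulVec, ← mulVec_mulVec u]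
    congr 1
    rw [hN, hwdef, dspOfVec_mulVec, hH, neg_mulVec, ← mulVec_mulVec, hcat_neg_one_mulVec, neg_sub]
    simp [hh, mulVec_diagonal]
  rw [hnorm] at hlim
  refine hlim.congr fun ε => congrArg sSup (Set.ext fun t => ?_)
  have hratio : ∀ u, IsUnit (M + N u).det →
      ‖(c⁻¹ • mulVecCLM (L * (M + N u)⁻¹ * H)) u‖ / ‖u‖ =
      infNormV (L *ᵥ ((M + N u)⁻¹ *ᵥ (b + fun i => b i * u (.inr i))) - L *ᵥ (M⁻¹ *ᵥ b)) / c /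
        infNormV u := by
    intro u hu
    rw [herr u hu, infNormV_eq_norm, infNormV_eq_norm, _root_.smul_apply, norm_smul,
      norm_inv, Real.norm_of_nonneg hc0, mulVecCLM_apply, inv_mul_eq_div]
  constructor
  · rintro ⟨u, hu, hpos, hle, rfl⟩
    obtain ⟨ΔA, ΔB, ΔC, ΔD, ΔE, hΔ⟩ := exists_vecG_eq fun i => a i * u (.inl i)
    have hdsp : dsp ΔA ΔB ΔC ΔD ΔE = N u := by rw [← dspOfVec_vecG, hΔ]
    have hs : scaledPert A B C D E b ΔA ΔB ΔC ΔD ΔE (fun i => b i * u (.inr i)) = u := by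
      ext (i | i)
      · simp [scaledPert, hΔ, ← ha, ha0]
      · simp [scaledPert, hbv]
    refine ⟨ΔA, ΔB, ΔC, ΔD, ΔE, fun i => b i * u (.inr i), ?_⟩
    rw [hdsp, hs, hratio u hu, infNormV_eq_norm u]
    exact ⟨hu, hpos, hle, rfl⟩
  · rintro ⟨ΔA, ΔB, ΔC, ΔD, ΔE, Δb, hu, hpos, hle, rfl⟩
    set u := scaledPert A B C D E b ΔA ΔB ΔC ΔD ΔE Δb with hudef
    have hdsp : dsp ΔA ΔB ΔC ΔD ΔE = N u := by
      rw [← dspOfVec_vecG, hN]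
      congr 1
      ext i
      simp [hudef, scaledPert, ← ha, ha0]
    have hΔb : Δb = fun i => b i * u (.inr i) := by
      ext i
      simp [hudef, scaledPert, hbv]
    rw [hdsp] at hu ⊢
    rw [infNormV_eq_norm] at hpos hle
    refine ⟨u, hu, hpos, hle, ?_⟩
    rw [hratio u hu, ← hΔb]

end
end

section
/- Let 𝔅 be nonsingular, b ∈ ℝ^l, L ∈ ℝ^{k×l}, and x ∈ ℝⁿ, y ∈ ℝᵐ, z ∈ ℝᵖ. Then the entrywise inequality |L·𝔅^{-1}·[𝒢, −I_l]| · [vec(|A|); vec(|B|); vec(|C|); vec(|D|); vec(|E|); |b|] ≤ |L·𝔅^{-1}| · ( ℋ + |b| ) holds, and consequently ‖ |L·𝔅^{-1}·[𝒢, −I_l]| · [vec(|A|); …; vec(|E|); |b|] ‖_∞ ≤ ‖ |L·𝔅^{-1}| · ( ℋ + |b| ) ‖_∞, where ℋ = [ |A|·|x| + |B|ᵀ·|y| ; |B|·|x| + |D|·|y| + |C|ᵀ·|z| ; |C|·|y| + |E|·|z| ] ∈ ℝ^l. -/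
open Matrix Filter Topology

noncomputable section

lemma absM_mul_mulVec_le {a b c : Type*} [Fintype b] [Fintype c] (M : Matrix a b ℝ)
    (N : Matrix b c ℝ) {v : c → ℝ} (hv : ∀ j, 0 ≤ v j) (i : a) :
    (absM (M * N)).mulVec v i ≤ (absM M).mulVec ((absM N).mulVec v) i := by
  rw [mulVec_mulVec]
  refine Finset.sum_le_sum fun j _ => mul_le_mul_of_nonneg_right ?_ (hv j)
  simp only [absM, of_apply, mul_apply, ← abs_mul]
  exact Finset.abs_sum_le_sum_abs _ _

lemma absM_mulVec_nonneg {a b : Type*} [Fintype b] (M : Matrix a b ℝ) {v : b → ℝ}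
    (hv : ∀ j, 0 ≤ v j) (i : a) : 0 ≤ (absM M).mulVec v i :=
  Finset.sum_nonneg fun j _ => mul_nonneg (abs_nonneg (M i j)) (hv j)

lemma infNormV_mono {ι : Type*} [Fintype ι] {u v : ι → ℝ} (hu : ∀ i, 0 ≤ u i)
    (huv : ∀ i, u i ≤ v i) : infNormV u ≤ infNormV v :=
  ciSup_mono (Set.finite_range _).bddAbove fun i => abs_le_abs_of_nonneg (hu i) (huv i)

lemma absM_hcat_mulVec_sumElim {a b c : Type*} [Fintype b] [Fintype c] (M : Matrix a b ℝ)
    (N : Matrix a c ℝ) (u : b → ℝ) (v : c → ℝ) :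
    (absM (hcat M N)).mulVec (Sum.elim u v) = (absM M).mulVec u + (absM N).mulVec v := by
  ext i
  simp [mulVec, dotProduct, absM, hcat]

lemma absM_neg_one_mulVec {a : Type*} [Fintype a] [DecidableEq a] (v : a → ℝ) :
    (absM (-1 : Matrix a a ℝ)).mulVec v = v := by
  ext i
  simp [mulVec, dotProduct, absM, one_apply, apply_ite abs]

lemma absM_calG_mulVec_vecG {n m p : ℕ}
    (A : Matrix (Fin n) (Fin n) ℝ) (B : Matrix (Fin m) (Fin n) ℝ) (C : Matrix (Fin p) (Fin m) ℝ)
    (D : Matrix (Fin m) (Fin m) ℝ) (E : Matrix (Fin p) (Fin p) ℝ)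
    (x : Fin n → ℝ) (y : Fin m → ℝ) (z : Fin p → ℝ) :
    (absM (calG x y z)).mulVec (vecG (absM A) (absM B) (absM C) (absM D) (absM E)) =
      calH A B C D E x y z := by
  ext (i | i | i) <;>
    simp [mulVec, dotProduct, absM, absV, calG, calH, vecG, vecC, Fintype.sum_prod_type,
      apply_ite abs, mul_comm]
  ring

lemma vecG_absM_nonneg {n m p : ℕ}
    (A : Matrix (Fin n) (Fin n) ℝ) (B : Matrix (Fin m) (Fin n) ℝ) (C : Matrix (Fin p) (Fin m) ℝ)
    (D : Matrix (Fin m) (Fin m) ℝ) (E : Matrix (Fin p) (Fin p) ℝ) (c : GIdx n m p) :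
    0 ≤ vecG (absM A) (absM B) (absM C) (absM D) (absM E) c := by
  rcases c with c | c | c | c | c <;> exact abs_nonneg _

/-- Corollary 3.2, key inequality: entrywise bound and the induced
∞-norm bound. -/
theorem stmt11 {n m p k : ℕ}
    (A : Matrix (Fin n) (Fin n) ℝ) (B : Matrix (Fin m) (Fin n) ℝ) (C : Matrix (Fin p) (Fin m) ℝ)
    (D : Matrix (Fin m) (Fin m) ℝ) (E : Matrix (Fin p) (Fin p) ℝ)
    (hB : IsUnit (dsp A B C D E).det) (b : Idx n m p → ℝ)
    (L : Matrix (Fin k) (Idx n m p) ℝ)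
    (x : Fin n → ℝ) (y : Fin m → ℝ) (z : Fin p → ℝ) :
    (∀ i, ((absM (L * (dsp A B C D E)⁻¹ *
            hcat (calG x y z) (-1 : Matrix (Idx n m p) (Idx n m p) ℝ))).mulVec
          (Sum.elim (vecG (absM A) (absM B) (absM C) (absM D) (absM E)) (absV b))) i ≤
        ((absM (L * (dsp A B C D E)⁻¹)).mulVec (calH A B C D E x y z + absV b)) i) ∧
      infNormV ((absM (L * (dsp A B C D E)⁻¹ *
            hcat (calG x y z) (-1 : Matrix (Idx n m p) (Idx n m p) ℝ))).mulVec
          (Sum.elim (vecG (absM A) (absM B) (absM C) (absM D) (absM E)) (absV b))) ≤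
        infNormV ((absM (L * (dsp A B C D E)⁻¹)).mulVec (calH A B C D E x y z + absV b)) := by
  have hv : ∀ c, 0 ≤ Sum.elim (vecG (absM A) (absM B) (absM C) (absM D) (absM E)) (absV b) c :=
    Sum.rec (vecG_absM_nonneg A B C D E) fun i => abs_nonneg (b i)
  have key := absM_mul_mulVec_le (L * (dsp A B C D E)⁻¹)
    (hcat (calG x y z) (-1 : Matrix (Idx n m p) (Idx n m p) ℝ)) hv
  rw [absM_hcat_mulVec_sumElim, absM_calG_mulVec_vecG, absM_neg_one_mulVec] at key
  exact ⟨key, infNormV_mono (absM_mulVec_nonneg _ hv) key⟩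

end
end
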